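/- There does not exist a smooth submersion from P² × P² to P³, where Pⁿ denotes n-dimensional real projective space. -/

import Mathlib

section

open MeasureTheory Set Metric Module Function
open scoped Topology Polynomial Manifold ContDiff

section Degree

variable {E : Type*} [NormedAddCommGroup E] [NormedSpace ℝ E]

theorem det_id_add_smul_pos [FiniteDimensional ℝ E] {A : E →L[ℝ] E} {t : ℝ} (h : ‖t • A‖ < 1) :
    0 < (ContinuousLinearMap.id ℝ E + t • A).det := by
  have key : ∀ s ∈ Icc (0 : ℝ) 1, (ContinuousLinearMap.id ℝ E + s • (t • A)).det ≠ 0 := by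
    intro s hs
    have hn : ‖-(s • (t • A))‖ < 1 := by
      rw [norm_neg, norm_smul, Real.norm_of_nonneg hs.1]
      nlinarith [norm_nonneg (t • A), hs.2, hs.1]
    have hu : IsUnit (ContinuousLinearMap.id ℝ E + s • (t • A)) := by
      have := (Units.oneSub _ hn).isUnit
      rw [Units.val_oneSub, sub_neg_eq_add] at this
      exact this
    obtain ⟨e, he⟩ := hu
    rw [← he]
    exact ((ContinuousLinearEquiv.unitsEquiv ℝ E e).toLinearEquiv.isUnit_det').ne_zero
  have hc : ContinuousOn (fun s : ℝ => (ContinuousLinearMap.id ℝ E + s • (t • A)).det)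
      (Icc 0 1) := by
    refine (ContinuousLinearMap.continuous_det.comp ?_).continuousOn
    fun_prop
  by_contra! hneg
  have h0 : (ContinuousLinearMap.id ℝ E + (0 : ℝ) • (t • A)).det = 1 := by
    rw [zero_smul, add_zero]
    exact LinearMap.det_id
  obtain ⟨s, hs, hs0⟩ := intermediate_value_Icc' (zero_le_one) hc
    (show (0 : ℝ) ∈ _ from ⟨by simpa using hneg, by rw [h0]; exact zero_le_one⟩)
  exact key s hs hs0

theorem hasFDerivAt_id_add_smul {u : E → E} (hu : ContDiff ℝ 1 u) (t : ℝ) (x : E) :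
    HasFDerivAt (fun x => x + t • u x) (ContinuousLinearMap.id ℝ E + t • fderiv ℝ u x) x :=
  (hasFDerivAt_id x).add ((hu.differentiable one_ne_zero x).hasFDerivAt.const_smul t)

variable [FiniteDimensional ℝ E]
variable [MeasurableSpace E] [BorelSpace E] (μ : Measure E) [μ.IsAddHaarMeasure]

theorem exists_setIntegral_small_perturbation_eq {u : E → E} (hu : ContDiff ℝ 1 u)
    {R : ℝ} (hR : ∀ x, R ≤ ‖x‖ → u x = 0) :
    ∃ δ > 0, ∀ t ∈ Ioo (0 : ℝ) δ, ∀ f : E → ℝ,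
      ∫ x in closedBall 0 R,
        f (x + t • u x) * (ContinuousLinearMap.id ℝ E + t • fderiv ℝ u x).det ∂μ =
      ∫ x in closedBall 0 R, f x ∂μ := by
  have hcs : HasCompactSupport u :=
    HasCompactSupport.intro (isCompact_closedBall 0 R) fun x hx => hR x (by
      simpa using (not_le.1 (fun h => hx (by simpa using h))).le)
  obtain ⟨C, hC⟩ := hu.lipschitzWith_of_hasCompactSupport hcs one_ne_zero
  refine ⟨((C : ℝ) + 1)⁻¹, by positivity, fun t ht f => ?_⟩
  have hC1 : (0 : ℝ) < C + 1 := by positivity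
  have htC : t * C < 1 := by
    have : t * (C + 1) < 1 := by
      have := mul_lt_mul_of_pos_right ht.2 hC1
      rwa [inv_mul_cancel₀ hC1.ne'] at this
    nlinarith [ht.1]
  have happ : ApproximatesLinearOn (fun x => x + t • u x)
      ((ContinuousLinearEquiv.refl ℝ E : E ≃L[ℝ] E) : E →L[ℝ] E) univ
      (t.toNNReal * C : NNReal) := by
    intro x _ y _
    have : (x + t • u x) - (y + t • u y) -
        ((ContinuousLinearEquiv.refl ℝ E : E ≃L[ℝ] E) : E →L[ℝ] E) (x - y) =
        t • (u x - u y) := by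
      simp [smul_sub]; abel
    rw [this, norm_smul, Real.norm_of_nonneg ht.1.le, NNReal.coe_mul,
      Real.coe_toNNReal t ht.1.le, mul_assoc]
    exact mul_le_mul_of_nonneg_left (by simpa [dist_eq_norm] using hC.dist_le_mul x y) ht.1.le
  have hc : Subsingleton E ∨ (t.toNNReal * C : NNReal) <
      ‖((ContinuousLinearEquiv.refl ℝ E).symm : E →L[ℝ] E)‖₊⁻¹ := by
    rcases subsingleton_or_nontrivial E with h | h
    · exact Or.inl h
    · right
      have : ‖((ContinuousLinearEquiv.refl ℝ E).symm : E →L[ℝ] E)‖₊ = 1 := by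
        rw [← NNReal.coe_inj, coe_nnnorm]
        exact ContinuousLinearMap.norm_id
      rw [this, inv_one, ← NNReal.coe_lt_coe, NNReal.coe_mul,
        Real.coe_toNNReal t ht.1.le]
      exact htC
  have hinj : Function.Injective (fun x => x + t • u x) :=
    (happ.toHomeomorph _ hc).injective
  have hsurj : Function.Surjective (fun x => x + t • u x) := happ.surjective hc
  have himg : (fun x => x + t • u x) '' closedBall 0 R = closedBall 0 R := by
    have hout : ∀ x, x ∉ closedBall (0 : E) R → x + t • u x = x := fun x hx => by
      rw [hR x (by simpa using (not_le.1 (fun h => hx (by simpa using h))).le)]; simp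
    ext y
    constructor
    · rintro ⟨x, hx, rfl⟩
      by_contra hy
      have := hinj (hout _ hy)
      exact hy (by simpa only [this] using hx)
    · intro hy
      obtain ⟨x, rfl⟩ := hsurj y
      refine ⟨x, ?_, rfl⟩
      by_contra hx
      exact hx (by simpa only [hout x hx] using hy)
  have hcv := integral_image_eq_integral_abs_det_fderiv_smul μ
    (measurableSet_closedBall (x := (0 : E)) (ε := R))
    (fun x _ => (hasFDerivAt_id_add_smul hu t x).hasFDerivWithinAt) hinj.injOn f
  rw [himg] at hcv
  rw [hcv]
  refine setIntegral_congr_fun measurableSet_closedBall fun x _ => ?_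
  have hpos : 0 < (ContinuousLinearMap.id ℝ E + t • fderiv ℝ u x).det := by
    refine det_id_add_smul_pos ?_
    rw [norm_smul, Real.norm_of_nonneg ht.1.le]
    exact (mul_le_mul_of_nonneg_left (norm_fderiv_le_of_lipschitz ℝ hC) ht.1.le).trans_lt htC
  simp only [abs_of_pos hpos, smul_eq_mul]
  ring

end Degree

section PolynomialFamily

variable {E : Type*} [NormedAddCommGroup E]

/-- Evaluate a polynomial with coefficients in `C(E, ℝ)` at the time `t` and the point `x`. -/
def evalTimeSpace (t : ℝ) (x : E) : C(E, ℝ)[X] →+* ℝ :=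
  Polynomial.eval₂RingHom (ContinuousMap.evalAlgHom ℝ ℝ x : C(E, ℝ) →+* ℝ) t

@[simp]
theorem evalTimeSpace_C (t : ℝ) (x : E) (f : C(E, ℝ)) :
    evalTimeSpace t x (Polynomial.C f) = f x := by
  simp [evalTimeSpace]

@[simp]
theorem evalTimeSpace_X (t : ℝ) (x : E) : evalTimeSpace t x Polynomial.X = t := by
  simp [evalTimeSpace]

theorem evalTimeSpace_eq_sum (t : ℝ) (x : E) (Q : C(E, ℝ)[X]) :
    evalTimeSpace t x Q = ∑ k ∈ Q.support, Q.coeff k x * t ^ k := by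
  simp [evalTimeSpace, Polynomial.eval₂_eq_sum, Polynomial.sum]

variable [MeasurableSpace E] [BorelSpace E] (μ : Measure E) [IsFiniteMeasureOnCompacts μ]

theorem exists_polynomial_setIntegral_evalTimeSpace {K : Set E} (hK : IsCompact K)
    (Q : C(E, ℝ)[X]) :
    ∃ P : ℝ[X], ∀ t, ∫ x in K, evalTimeSpace t x Q ∂μ = P.eval t := by
  refine ⟨∑ k ∈ Q.support, Polynomial.C (∫ x in K, Q.coeff k x ∂μ) * Polynomial.X ^ k,
    fun t => ?_⟩
  simp_rw [evalTimeSpace_eq_sum]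
  rw [integral_finsetSum _ fun k _ => by
    have : Continuous fun x => Q.coeff k x * t ^ k := by fun_prop
    exact this.continuousOn.integrableOn_compact hK]
  simp [Polynomial.eval_finsetSum, integral_mul_const]

/-- If the integral of a polynomial family is constant for small positive times, it is constant. -/
theorem setIntegral_evalTimeSpace_eq_of_small {K : Set E} (hK : IsCompact K) {Q : C(E, ℝ)[X]}
    {δ c : ℝ} (hδ : 0 < δ)
    (h : ∀ t ∈ Ioo 0 δ, ∫ x in K, evalTimeSpace t x Q ∂μ = c) (t : ℝ) :
    ∫ x in K, evalTimeSpace t x Q ∂μ = c := by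
  obtain ⟨P, hP⟩ := exists_polynomial_setIntegral_evalTimeSpace μ hK Q
  have : P = Polynomial.C c := by
    refine Polynomial.eq_of_infinite_eval_eq _ _ ((Ioo_infinite hδ).mono fun s hs => ?_)
    simp [← hP, h s hs]
  rw [hP, this, Polynomial.eval_C]

end PolynomialFamily

section PerturbationDegree

variable {E : Type*} [NormedAddCommGroup E] [NormedSpace ℝ E]

theorem exists_evalTimeSpace_eq_comp {u : E → E} (hu : Continuous u) {f : C(E, ℝ)}
    (hf : f ∈ Algebra.adjoin ℝ (range fun l : StrongDual ℝ E => (⟨l, l.continuous⟩ : C(E, ℝ)))) :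
    ∃ Q : C(E, ℝ)[X], ∀ t x, evalTimeSpace t x Q = f (x + t • u x) := by
  induction hf using Algebra.adjoin_induction with
  | mem f hf =>
    obtain ⟨l, rfl⟩ := hf
    refine ⟨Polynomial.C ⟨l, l.continuous⟩ +
      Polynomial.X * Polynomial.C ⟨fun x => l (u x), l.continuous.comp hu⟩, fun t x => ?_⟩
    simpa using mul_comm _ _
  | algebraMap r =>
    exact ⟨Polynomial.C (algebraMap ℝ C(E, ℝ) r), fun t x => by simp⟩
  | add f g _ _ hf hg =>
    obtain ⟨P, hP⟩ := hf
    obtain ⟨Q, hQ⟩ := hg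
    exact ⟨P + Q, fun t x => by simp [hP, hQ]⟩
  | mul f g _ _ hf hg =>
    obtain ⟨P, hP⟩ := hf
    obtain ⟨Q, hQ⟩ := hg
    exact ⟨P * Q, fun t x => by simp [hP, hQ]⟩

theorem exists_evalTimeSpace_eq_det [FiniteDimensional ℝ E] {A : E → E →L[ℝ] E}
    (hA : Continuous A) :
    ∃ Q : C(E, ℝ)[X], ∀ t x,
      evalTimeSpace t x Q = (ContinuousLinearMap.id ℝ E + t • A x).det := by
  let b := Module.finBasis ℝ E
  have hc : ∀ i j, Continuous fun x => b.repr (A x (b j)) i := fun i j =>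
    (LinearMap.continuous_of_finiteDimensional (b.coord i)).comp (hA.clm_apply continuous_const)
  let M : Matrix (Fin (Module.finrank ℝ E)) (Fin (Module.finrank ℝ E)) C(E, ℝ)[X] :=
    1 + Matrix.of fun i j => Polynomial.X * Polynomial.C ⟨_, hc i j⟩
  refine ⟨M.det, fun t x => ?_⟩
  rw [RingHom.map_det, ContinuousLinearMap.det, ← LinearMap.det_toMatrix b]
  congr 1
  ext i j
  simp [M, LinearMap.toMatrix_apply, Matrix.one_apply, apply_ite (evalTimeSpace t x),
    Finsupp.single_apply, eq_comm]
  exact mul_comm _ _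

variable [FiniteDimensional ℝ E]
variable [MeasurableSpace E] [BorelSpace E] (μ : Measure E) [μ.IsAddHaarMeasure]

/-- A compactly supported perturbation of the identity has degree one. -/
theorem setIntegral_comp_id_add_mul_det_eq {u : E → E} (hu : ContDiff ℝ 1 u)
    {R : ℝ} (hR : ∀ x, R ≤ ‖x‖ → u x = 0) {φ : E → ℝ} (hφ : Continuous φ) :
    ∫ x in closedBall 0 R,
      φ (x + u x) * (ContinuousLinearMap.id ℝ E + fderiv ℝ u x).det ∂μ =
    ∫ x in closedBall 0 R, φ x ∂μ := by
  set S := Algebra.adjoin ℝ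
    (range fun l : StrongDual ℝ E => (⟨l, l.continuous⟩ : C(E, ℝ))) with hS
  have hsep : S.SeparatesPoints := by
    intro x y hxy
    obtain ⟨l, hl⟩ := SeparatingDual.exists_separating_of_ne (R := ℝ) hxy
    exact ⟨_, ⟨_, Algebra.subset_adjoin ⟨l, rfl⟩, rfl⟩, hl⟩
  have hcB : IsCompact (closedBall (0 : E) R) := isCompact_closedBall 0 R
  have hdu := hu.continuous_fderiv one_ne_zero
  have hdet : Continuous fun x => (ContinuousLinearMap.id ℝ E + fderiv ℝ u x).det :=
    ContinuousLinearMap.continuous_det.comp (by fun_prop)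
  have hF : Continuous fun x => x + u x := continuous_id.add hu.continuous
  have hmem : ∀ f ∈ S, ∫ x in closedBall 0 R,
      f (x + u x) * (ContinuousLinearMap.id ℝ E + fderiv ℝ u x).det ∂μ =
      ∫ x in closedBall 0 R, f x ∂μ := by
    intro f hf
    obtain ⟨P, hP⟩ := exists_evalTimeSpace_eq_comp hu.continuous hf
    obtain ⟨Q, hQ⟩ := exists_evalTimeSpace_eq_det hdu
    obtain ⟨δ, hδ, h⟩ := exists_setIntegral_small_perturbation_eq μ hu hR
    have := setIntegral_evalTimeSpace_eq_of_small μ hcB (Q := P * Q) hδ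
      (fun t ht => by simpa only [map_mul, hP, hQ] using h t ht f) 1
    simpa only [map_mul, hP, hQ, one_smul] using this
  set D := ∫ x in closedBall 0 R, |(ContinuousLinearMap.id ℝ E + fderiv ℝ u x).det| ∂μ with hD
  have hD0 : 0 ≤ D := integral_nonneg fun _ => abs_nonneg _
  set V := μ.real (closedBall (0 : E) R)
  have hV0 : 0 ≤ V := measureReal_nonneg
  have hint : ∀ f : E → ℝ, Continuous f → IntegrableOn f (closedBall 0 R) μ :=
    fun f hf => hf.continuousOn.integrableOn_compact hcB
  refine eq_of_forall_dist_le fun η hη => ?_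
  obtain ⟨f, hfS, hf⟩ :=
    ContinuousMap.exists_mem_subalgebra_near_continuous_of_isCompact_of_separatesPoints hsep
      ⟨φ, hφ⟩ (hcB.union (hcB.image hF)) (ε := η / (D + V + 1)) (by positivity)
  set ε := η / (D + V + 1) with hε
  have hε0 : 0 < ε := by positivity
  have h1 : |∫ x in closedBall 0 R,
      φ (x + u x) * (ContinuousLinearMap.id ℝ E + fderiv ℝ u x).det ∂μ -
      ∫ x in closedBall 0 R,
      f (x + u x) * (ContinuousLinearMap.id ℝ E + fderiv ℝ u x).det ∂μ| ≤ ε * D := by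
    have hc : ∀ h : E → ℝ, Continuous h → Continuous fun x =>
        h (x + u x) * (ContinuousLinearMap.id ℝ E + fderiv ℝ u x).det :=
      fun h hh => (hh.comp hF).mul hdet
    rw [← integral_sub (hint _ (hc φ hφ)) (hint _ (hc f f.continuous)), hD,
      ← integral_const_mul]
    refine (abs_integral_le_integral_abs).trans (setIntegral_mono_on
      (hint _ ((hc φ hφ).sub (hc f f.continuous)).abs)
      (hint _ (continuous_const.mul hdet.abs)) measurableSet_closedBall fun x hx => ?_)
    rw [← sub_mul, abs_mul]
    have := (hf _ (Or.inr ⟨x, hx, rfl⟩)).le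
    rw [norm_sub_rev] at this
    exact mul_le_mul_of_nonneg_right this (abs_nonneg _)
  have h2 : |∫ x in closedBall 0 R, f x ∂μ - ∫ x in closedBall 0 R, φ x ∂μ| ≤ ε * V := by
    rw [← integral_sub (hint _ f.continuous) (hint _ hφ)]
    exact norm_setIntegral_le_of_norm_le_const hcB.measure_lt_top
      fun x hx => (hf x (Or.inl hx)).le
  have h3 : ε * (D + V + 1) = η := div_mul_cancel₀ _ (by positivity)
  rw [hmem f hfS] at h1
  rw [Real.dist_eq]
  rw [abs_le] at *
  constructor <;> nlinarith

theorem integral_comp_mul_det_sub_eq_zero {W₀ W₁ : E → E} (h₀ : ContDiff ℝ 1 W₀)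
    (h₁ : ContDiff ℝ 1 W₁) (hcs : HasCompactSupport (W₁ - W₀)) {φ : E → ℝ} (hφ : Continuous φ) :
    ∫ x, (φ (W₁ x) * (fderiv ℝ W₁ x).det - φ (W₀ x) * (fderiv ℝ W₀ x).det) ∂μ = 0 := by
  obtain ⟨r, hr0, hr⟩ := hcs.isCompact.isBounded.subset_ball_lt 0 0
  let θ : ContDiffBump (0 : E) := ⟨r, r + 1, hr0, by linarith⟩
  have hθ : ContDiff ℝ 1 θ := θ.contDiff
  set R := r + 1 with hRdef
  let u : (E → E) → E → E := fun W x => θ x • (W x - x)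
  have hu : ∀ W, ContDiff ℝ 1 W → ContDiff ℝ 1 (u W) := fun W hW =>
    hθ.smul (hW.sub contDiff_id)
  have huR : ∀ W x, R ≤ ‖x‖ → u W x = 0 := fun W x hx => by
    have : θ x = 0 := θ.zero_of_le_dist (by simpa using hx)
    simp [u, this]
  have hin : ∀ W x, x ∈ ball (0 : E) r → (fun y => y + u W y) =ᶠ[𝓝 x] W := fun W x hx => by
    filter_upwards [θ.eventuallyEq_one_of_mem_ball hx] with y hy
    simp [u, hy]
  have hfd : ∀ W, ContDiff ℝ 1 W → ∀ x,
      fderiv ℝ (fun y => y + u W y) x = ContinuousLinearMap.id ℝ E + fderiv ℝ (u W) x :=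
    fun W hW x =>
      ((hasFDerivAt_id x).add ((hu W hW).differentiable one_ne_zero x).hasFDerivAt).fderiv
  have hout : ∀ x, x ∉ ball (0 : E) r → W₁ =ᶠ[𝓝 x] W₀ := fun x hx => by
    have := notMem_tsupport_iff_eventuallyEq.1 fun h => hx (hr h)
    filter_upwards [this] with y hy
    exact sub_eq_zero.1 hy
  let g : (E → E) → E → ℝ := fun W x => φ (W x) * (fderiv ℝ W x).det
  have hg : ∀ W W' : E → E, ∀ x, W =ᶠ[𝓝 x] W' → g W x = g W' x := fun W W' x h => by
    simp only [g, h.eq_of_nhds, h.fderiv_eq]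
  have hpt : ∀ x, g W₁ x - g W₀ x =
      g (fun y => y + u W₁ y) x - g (fun y => y + u W₀ y) x := by
    intro x
    by_cases hx : x ∈ ball (0 : E) r
    · rw [hg _ _ x (hin W₁ x hx), hg _ _ x (hin W₀ x hx)]
    · rw [hg _ _ x (hout x hx), sub_self,
        hg (fun y => y + u W₁ y) (fun y => y + u W₀ y) x, sub_self]
      filter_upwards [hout x hx] with y hy
      simp only [u, hy]
  have hgc : ∀ W, ContDiff ℝ 1 W → Continuous (g W) := fun W hW =>
    (hφ.comp hW.continuous).mul
      (ContinuousLinearMap.continuous_det.comp (hW.continuous_fderiv one_ne_zero))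
  have hI : ∀ W, ContDiff ℝ 1 W →
      ∫ x in closedBall 0 R, g (fun y => y + u W y) x ∂μ = ∫ x in closedBall 0 R, φ x ∂μ := by
    intro W hW
    rw [← setIntegral_comp_id_add_mul_det_eq μ (hu W hW) (huR W) hφ]
    simp only [g, hfd W hW]
  have hii : ∀ W, ContDiff ℝ 1 W →
      IntegrableOn (g (fun y => y + u W y)) (closedBall 0 R) μ := fun W hW =>
    (hgc _ (contDiff_id.add (hu W hW))).continuousOn.integrableOn_compact
      (isCompact_closedBall 0 R)
  change ∫ x, (g W₁ x - g W₀ x) ∂μ = 0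
  rw [← setIntegral_eq_integral_of_forall_compl_eq_zero (s := closedBall 0 R)]
  · simp_rw [hpt]
    rw [integral_sub (hii _ h₁) (hii _ h₀), hI _ h₁, hI _ h₀, sub_self]
  · intro x hx
    rw [hg _ _ x (hout x fun h => hx (ball_subset_closedBall
      (ball_subset_ball (by linarith) h))), sub_self]

/-- Two maps that differ by a compactly supported perturbation cannot be such that one avoids
zero on the support of the perturbation, while the other one has zeros there, all of them
nondegenerate and positively oriented. -/
theorem exists_zero_of_positive_zeros {W₀ W₁ : E → E} (h₀ : ContDiff ℝ 1 W₀)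
    (h₁ : ContDiff ℝ 1 W₁) {K : Set E} (hK : IsCompact K) (hsupp : ∀ x, x ∉ K → W₁ =ᶠ[𝓝 x] W₀)
    (hpos : ∀ x ∈ K, W₁ x = 0 → 0 < (fderiv ℝ W₁ x).det) {x₁ : E} (hx₁ : x₁ ∈ K)
    (hzero : W₁ x₁ = 0) : ∃ x ∈ K, W₀ x = 0 := by
  borelize E
  by_contra! hne
  have hd₁ : Continuous fun x => (fderiv ℝ W₁ x).det :=
    ContinuousLinearMap.continuous_det.comp (h₁.continuous_fderiv one_ne_zero)
  have hd₀ : Continuous fun x => (fderiv ℝ W₀ x).det :=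
    ContinuousLinearMap.continuous_det.comp (h₀.continuous_fderiv one_ne_zero)
  have hlow : ∀ (W : E → E) (L : Set E), Continuous W → IsCompact L → (∀ x ∈ L, W x ≠ 0) →
      ∃ ε > 0, ∀ x ∈ L, ε ≤ ‖W x‖ := by
    intro W L hW hL hWL
    obtain ⟨ε, hε, h⟩ := hL.exists_forall_le' (f := fun x => ‖W x‖) hW.norm.continuousOn
      (a := 0) fun x hx => norm_pos_iff.2 (hWL x hx)
    exact ⟨ε, hε, h⟩
  obtain ⟨ε₀, hε₀, hW₀⟩ := hlow W₀ K h₀.continuous hK hne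
  obtain ⟨ε₁, hε₁, hW₁⟩ := hlow W₁ (K ∩ {x | (fderiv ℝ W₁ x).det ≤ 0}) h₁.continuous
    (hK.inter_right (isClosed_le hd₁ continuous_const))
    fun x hx h => (hpos x hx.1 h).not_ge hx.2
  let φ : E → ℝ := fun y => max 0 (min ε₀ ε₁ - ‖y‖)
  have hφ : Continuous φ := by fun_prop
  have hφ0 : ∀ y, 0 ≤ φ y := fun y => le_max_left _ _
  have hφz : ∀ y, min ε₀ ε₁ ≤ ‖y‖ → φ y = 0 := fun y hy => max_eq_left (by linarith)
  let h : E → ℝ := fun x => φ (W₁ x) * (fderiv ℝ W₁ x).det - φ (W₀ x) * (fderiv ℝ W₀ x).det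
  have hcont : Continuous h :=
    ((hφ.comp h₁.continuous).mul hd₁).sub ((hφ.comp h₀.continuous).mul hd₀)
  have hout : ∀ x, x ∉ K → h x = 0 := fun x hx => by
    simp only [h, (hsupp x hx).eq_of_nhds, (hsupp x hx).fderiv_eq, sub_self]
  have hK' : ∀ x ∈ K, h x = φ (W₁ x) * (fderiv ℝ W₁ x).det := fun x hx => by
    simp only [h, hφz _ ((min_le_left _ _).trans (hW₀ x hx)), zero_mul, sub_zero]
  have hnonneg : 0 ≤ h := fun x => by
    by_cases hx : x ∈ K
    · rw [hK' x hx]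
      rcases le_or_gt (fderiv ℝ W₁ x).det 0 with hd | hd
      · simp [hφz _ ((min_le_right _ _).trans (hW₁ x ⟨hx, hd⟩))]
      · exact mul_nonneg (hφ0 _) hd.le
    · exact (hout x hx).ge
  have hx₁' : h x₁ ≠ 0 := by
    rw [hK' x₁ hx₁]
    refine mul_ne_zero ?_ (hpos x₁ hx₁ hzero).ne'
    have : 0 < min ε₀ ε₁ := lt_min hε₀ hε₁
    simpa [φ, hzero] using this
  have hposint := hcont.integral_pos_of_hasCompactSupport_nonneg_nonzero
    (μ := (MeasureTheory.Measure.addHaar : Measure E)) (.intro hK hout) hnonneg hx₁'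
  refine hposint.ne' (integral_comp_mul_det_sub_eq_zero _ h₀ h₁ (.intro hK fun x hx => ?_) hφ)
  simp [(hsupp x hx).eq_of_nhds]

end PerturbationDegree

section TangentFields

local notation "ℝ³" => EuclideanSpace ℝ (Fin 3)

/-- The quarter turn about the third axis, killing that axis. -/
noncomputable def axialRotation : ℝ³ →L[ℝ] ℝ³ :=
  LinearMap.toContinuousLinearMap
    (Matrix.toLpLin 2 2 !![0, -1, 0; 1, 0, 0; 0, 0, 0])

theorem axialRotation_apply (a : ℝ³) : axialRotation a = !₂[-a 1, a 0, 0] := by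
  ext i
  fin_cases i <;> simp [axialRotation, Matrix.toLpLin_apply, dotProduct,
    Fin.sum_univ_three]

theorem inner_axialRotation_self (a : ℝ³) : inner ℝ a (axialRotation a) = 0 := by
  simp [axialRotation_apply, PiLp.inner_apply, Fin.sum_univ_three]
  ring

theorem axialRotation_eq_zero_iff {a : ℝ³} : axialRotation a = 0 ↔ a 0 = 0 ∧ a 1 = 0 := by
  rw [axialRotation_apply]
  constructor
  · intro h
    exact ⟨by simpa using congrArg (fun z : ℝ³ => z 1) h,
      by simpa using congrArg (fun z : ℝ³ => z 0) h⟩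
  · rintro ⟨h0, h1⟩
    ext i
    fin_cases i <;> simp [h0, h1]

/-- The radial vector field vanishing exactly at the origin and on the unit sphere. -/
noncomputable def radialField (a : ℝ³) : ℝ³ := (‖a‖ ^ 2 - 1) • a

theorem contDiff_radialField : ContDiff ℝ 1 radialField :=
  ((contDiff_norm_sq ℝ).sub contDiff_const).smul contDiff_id

theorem norm_eq_one_of_radialField_add_eq_zero {a w : ℝ³} (ha : a ≠ 0) (hw : inner ℝ a w = 0)
    (h : radialField a + w = 0) : ‖a‖ = 1 ∧ w = 0 := by
  have h1 : inner ℝ a (radialField a + w) = (‖a‖ ^ 2 - 1) * ‖a‖ ^ 2 := by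
    rw [inner_add_right, hw, radialField, inner_smul_right, real_inner_self_eq_norm_sq, add_zero]
  rw [h, inner_zero_right] at h1
  have ha' := norm_pos_iff.2 ha
  have h2 : ‖a‖ ^ 2 - 1 = 0 := by
    rcases mul_eq_zero.1 h1.symm with h | h
    · exact h
    · exact absurd h (by positivity)
  rw [radialField, h2, zero_smul, zero_add] at h
  exact ⟨by nlinarith, h⟩

theorem hasFDerivAt_radialField_add_axialRotation {a : ℝ³} (ha : ‖a‖ = 1) :
    HasFDerivAt (fun x => radialField x + axialRotation x)
      ((2 : ℝ) • (innerSL ℝ a).smulRight a + axialRotation) a := by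
  refine HasFDerivAt.add ?_ axialRotation.hasFDerivAt
  have h := (((hasStrictFDerivAt_norm_sq a).hasFDerivAt.sub_const 1).smul (hasFDerivAt_id a))
  refine h.congr_fderiv ?_
  ext x
  simp [ha, two_smul, add_mul]

theorem det_prodMap_self_pos {E : Type*} [AddCommGroup E] [Module ℝ E] [FiniteDimensional ℝ E]
    {T : E →ₗ[ℝ] E} (hT : ∀ x, T x = 0 → x = 0) : 0 < (T.prodMap T).det := by
  rw [LinearMap.det_prodMap]
  refine mul_self_pos.2 fun h => ?_
  obtain ⟨x, hx, hx0⟩ := Submodule.exists_mem_ne_zero_of_ne_bot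
    (LinearMap.bot_lt_ker_of_det_eq_zero h).ne'
  exact hx0 (hT x hx)

/-- The derivative at the poles of the sum of the radial and the rotation field. -/
noncomputable def poleDerivative : ℝ³ →L[ℝ] ℝ³ :=
  (2 : ℝ) • (EuclideanSpace.proj 2).smulRight (EuclideanSpace.single 2 1) + axialRotation

theorem eq_zero_of_poleDerivative_eq_zero {x : ℝ³} (hx : poleDerivative x = 0) : x = 0 := by
  rw [poleDerivative, add_apply, axialRotation_apply] at hx
  have h0 := congrArg (fun z : ℝ³ => z 0) hx
  have h1 := congrArg (fun z : ℝ³ => z 1) hx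
  have h2 := congrArg (fun z : ℝ³ => z 2) hx
  simp at h0 h1 h2
  ext i
  fin_cases i
  · simpa using h1
  · simpa using h0
  · simpa using h2

theorem hasFDerivAt_radialField_add_axialRotation_pole {a : ℝ³} (ha : ‖a‖ = 1)
    (hJ : axialRotation a = 0) :
    HasFDerivAt (fun x => radialField x + axialRotation x) poleDerivative a := by
  refine (hasFDerivAt_radialField_add_axialRotation ha).congr_fderiv ?_
  obtain ⟨h0, h1⟩ := axialRotation_eq_zero_iff.1 hJ
  have hsq : a 2 * a 2 = 1 := by
    have := EuclideanSpace.norm_sq_eq a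
    simpa [ha, h0, h1, Fin.sum_univ_three, eq_comm, ← sq] using this
  ext x i
  fin_cases i <;>
    simp [poleDerivative, PiLp.inner_apply, Fin.sum_univ_three, h0, h1, mul_assoc, hsq]

/-- A cutoff function equal to one near `S² × S²` and supported away from the axes. -/
noncomputable def sphereProdCutoff (p : ℝ³ × ℝ³) : ℝ :=
  let η : ContDiffBump (1 : ℝ) := ⟨1 / 4, 1 / 2, by norm_num, by norm_num⟩
  η (‖p.1‖ ^ 2) * η (‖p.2‖ ^ 2)

/-- A compact neighbourhood of `S² × S²` away from the axes. -/
def sphereProdShell : Set (ℝ³ × ℝ³) :=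
  {p | ‖p.1‖ ^ 2 ∈ closedBall (1 : ℝ) (1 / 2) ∧ ‖p.2‖ ^ 2 ∈ closedBall (1 : ℝ) (1 / 2)}

theorem contDiff_sphereProdCutoff : ContDiff ℝ 1 sphereProdCutoff :=
  ((ContDiffBump.contDiff _).comp ((contDiff_norm_sq ℝ).comp contDiff_fst)).mul
    ((ContDiffBump.contDiff _).comp ((contDiff_norm_sq ℝ).comp contDiff_snd))

theorem sphereProdCutoff_eventuallyEq_one {p : ℝ³ × ℝ³} (h₁ : ‖p.1‖ = 1) (h₂ : ‖p.2‖ = 1) :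
    sphereProdCutoff =ᶠ[𝓝 p] 1 := by
  let η : ContDiffBump (1 : ℝ) := ⟨1 / 4, 1 / 2, by norm_num, by norm_num⟩
  have hc₁ : Filter.Tendsto (fun q : ℝ³ × ℝ³ => ‖q.1‖ ^ 2) (𝓝 p) (𝓝 1) :=
    Continuous.tendsto' (by fun_prop) _ _ (by simp [h₁])
  have hc₂ : Filter.Tendsto (fun q : ℝ³ × ℝ³ => ‖q.2‖ ^ 2) (𝓝 p) (𝓝 1) :=
    Continuous.tendsto' (by fun_prop) _ _ (by simp [h₂])
  filter_upwards [hc₁.eventually η.eventuallyEq_one, hc₂.eventually η.eventuallyEq_one]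
    with q hq₁ hq₂
  have : sphereProdCutoff q = η (‖q.1‖ ^ 2) * η (‖q.2‖ ^ 2) := rfl
  simp [this, hq₁, hq₂]

theorem sphereProdCutoff_eq_zero {p : ℝ³ × ℝ³} (hp : p ∉ sphereProdShell) :
    sphereProdCutoff p = 0 := by
  let η : ContDiffBump (1 : ℝ) := ⟨1 / 4, 1 / 2, by norm_num, by norm_num⟩
  have : sphereProdCutoff p = η (‖p.1‖ ^ 2) * η (‖p.2‖ ^ 2) := rfl
  rw [this]
  simp only [sphereProdShell, mem_ofPred_eq, not_and_or, mem_closedBall, not_le] at hp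
  rcases hp with hp | hp
  · rw [η.zero_of_le_dist hp.le, zero_mul]
  · rw [η.zero_of_le_dist hp.le, mul_zero]

theorem isClosed_sphereProdShell : IsClosed sphereProdShell :=
  (isClosed_closedBall.preimage (by fun_prop)).inter (isClosed_closedBall.preimage (by fun_prop))

theorem isCompact_sphereProdShell : IsCompact sphereProdShell := by
  refine isCompact_of_isClosed_isBounded isClosed_sphereProdShell
    (isBounded_closedBall.subset (s := sphereProdShell) (t := closedBall 0 2) fun p hp => ?_)
  have h₁ := (Real.closedBall_eq_Icc ▸ hp.1 : ‖p.1‖ ^ 2 ∈ Icc _ _).2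
  have h₂ := (Real.closedBall_eq_Icc ▸ hp.2 : ‖p.2‖ ^ 2 ∈ Icc _ _).2
  rw [mem_closedBall_zero_iff, Prod.norm_def]
  exact max_le (by nlinarith [norm_nonneg p.1]) (by nlinarith [norm_nonneg p.2])

theorem ne_zero_of_mem_sphereProdShell {p : ℝ³ × ℝ³} (hp : p ∈ sphereProdShell) :
    p.1 ≠ 0 ∧ p.2 ≠ 0 := by
  have h₁ := (Real.closedBall_eq_Icc ▸ hp.1 : ‖p.1‖ ^ 2 ∈ Icc _ _).1
  have h₂ := (Real.closedBall_eq_Icc ▸ hp.2 : ‖p.2‖ ^ 2 ∈ Icc _ _).1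
  constructor <;> intro h
  · norm_num [h] at h₁
  · norm_num [h] at h₂

/-- The perturbation of the radial field by a cut off tangential field. -/
noncomputable def perturbedRadialField (v : ℝ³ × ℝ³ → ℝ³ × ℝ³) (p : ℝ³ × ℝ³) : ℝ³ × ℝ³ :=
  (radialField p.1, radialField p.2) + sphereProdCutoff p • v p

theorem contDiff_perturbedRadialField {v : ℝ³ × ℝ³ → ℝ³ × ℝ³}
    (hv : ContDiffOn ℝ 1 v {p | p.1 ≠ 0 ∧ p.2 ≠ 0}) : ContDiff ℝ 1 (perturbedRadialField v) := by
  refine ((contDiff_radialField.comp contDiff_fst).prodMk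
    (contDiff_radialField.comp contDiff_snd)).add (contDiff_iff_contDiffAt.2 fun p => ?_)
  by_cases hp : p ∈ sphereProdShell
  · have hopen : IsOpen {p : ℝ³ × ℝ³ | p.1 ≠ 0 ∧ p.2 ≠ 0} :=
      (isOpen_ne.preimage continuous_fst).inter (isOpen_ne.preimage continuous_snd)
    exact contDiff_sphereProdCutoff.contDiffAt.smul
      (hv.contDiffAt (hopen.mem_nhds (ne_zero_of_mem_sphereProdShell hp)))
  · refine (contDiffAt_const (c := 0)).congr_of_eventuallyEq ?_
    filter_upwards [isClosed_sphereProdShell.isOpen_compl.mem_nhds hp] with q hq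
    simp [sphereProdCutoff_eq_zero hq]

theorem perturbedRadialField_eq_zero {v : ℝ³ × ℝ³ → ℝ³ × ℝ³} {p : ℝ³ × ℝ³}
    (hv : inner ℝ p.1 (v p).1 = 0 ∧ inner ℝ p.2 (v p).2 = 0) (hp : p ∈ sphereProdShell)
    (h : perturbedRadialField v p = 0) : ‖p.1‖ = 1 ∧ ‖p.2‖ = 1 ∧ v p = 0 := by
  obtain ⟨hp₁, hp₂⟩ := ne_zero_of_mem_sphereProdShell hp
  obtain ⟨h₁, hv₁⟩ := norm_eq_one_of_radialField_add_eq_zero hp₁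
    (w := sphereProdCutoff p • (v p).1) (by rw [inner_smul_right, hv.1, mul_zero])
    (congrArg Prod.fst h)
  obtain ⟨h₂, hv₂⟩ := norm_eq_one_of_radialField_add_eq_zero hp₂
    (w := sphereProdCutoff p • (v p).2) (by rw [inner_smul_right, hv.2, mul_zero])
    (congrArg Prod.snd h)
  have hc := (sphereProdCutoff_eventuallyEq_one h₁ h₂).eq_of_nhds
  rw [hc, Pi.one_apply, one_smul] at hv₁ hv₂
  exact ⟨h₁, h₂, Prod.ext hv₁ hv₂⟩

/-- Every tangent vector field of `S² × S²` has a zero. -/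
theorem exists_zero_of_tangent_field {v : ℝ³ × ℝ³ → ℝ³ × ℝ³}
    (hv : ContDiffOn ℝ 1 v {p | p.1 ≠ 0 ∧ p.2 ≠ 0})
    (htan : ∀ p : ℝ³ × ℝ³, p.1 ≠ 0 → p.2 ≠ 0 →
      inner ℝ p.1 (v p).1 = 0 ∧ inner ℝ p.2 (v p).2 = 0) :
    ∃ p : ℝ³ × ℝ³, ‖p.1‖ = 1 ∧ ‖p.2‖ = 1 ∧ v p = 0 := by
  let J : ℝ³ × ℝ³ →L[ℝ] ℝ³ × ℝ³ := axialRotation.prodMap axialRotation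
  have hJtan : ∀ p : ℝ³ × ℝ³, inner ℝ p.1 (J p).1 = 0 ∧ inner ℝ p.2 (J p).2 = 0 := fun p =>
    ⟨inner_axialRotation_self p.1, inner_axialRotation_self p.2⟩
  let e : ℝ³ := EuclideanSpace.single 2 1
  have he : ‖e‖ = 1 := by simp [e]
  have hJe : axialRotation e = 0 := by simp [axialRotation_eq_zero_iff, e]
  have hout : ∀ p, p ∉ sphereProdShell → perturbedRadialField J =ᶠ[𝓝 p] perturbedRadialField v := by
    intro p hp
    filter_upwards [isClosed_sphereProdShell.isOpen_compl.mem_nhds hp] with q hq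
    simp [perturbedRadialField, sphereProdCutoff_eq_zero hq]
  have hpos : ∀ p ∈ sphereProdShell, perturbedRadialField J p = 0 →
      0 < (fderiv ℝ (perturbedRadialField J) p).det := by
    intro p hp h
    obtain ⟨h₁, h₂, hJp⟩ := perturbedRadialField_eq_zero (hJtan p) hp h
    have hF : HasFDerivAt (perturbedRadialField J) (poleDerivative.prodMap poleDerivative) p := by
      refine HasFDerivAt.congr_of_eventuallyEq
        (HasFDerivAt.prodMap p
          (hasFDerivAt_radialField_add_axialRotation_pole h₁ (congrArg Prod.fst hJp))
          (hasFDerivAt_radialField_add_axialRotation_pole h₂ (congrArg Prod.snd hJp))) ?_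
      filter_upwards [sphereProdCutoff_eventuallyEq_one h₁ h₂] with q hq
      simp only [perturbedRadialField, hq, Pi.one_apply, one_smul]
      rfl
    rw [hF.fderiv]
    exact det_prodMap_self_pos (T := (poleDerivative : ℝ³ →ₗ[ℝ] ℝ³))
      fun x => eq_zero_of_poleDerivative_eq_zero
  obtain ⟨p, hp, hp0⟩ := exists_zero_of_positive_zeros (contDiff_perturbedRadialField hv)
    (contDiff_perturbedRadialField J.contDiff.contDiffOn) isCompact_sphereProdShell hout hpos
    (x₁ := (e, e)) (by simp [sphereProdShell, he]) (by
      simp [perturbedRadialField, radialField, he, J, hJe])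
  obtain ⟨hp₁, hp₂⟩ := ne_zero_of_mem_sphereProdShell hp
  exact ⟨p, perturbedRadialField_eq_zero (htan p hp₁ hp₂) hp hp0⟩

end TangentFields

section KernelField

theorem Matrix.det_updateCol_ne_zero_of_mulVec_eq_zero {ι K : Type*} [Fintype ι] [DecidableEq ι]
    [Field K] {A : Matrix ι ι K} {c k : ι → K} (hk : A.mulVec k = 0) {i : ι} (hi : k i ≠ 0)
    (hspan : ∀ y, ∃ x, ∃ s : K, A.mulVec x + s • c = y) : (A.updateCol i c).det ≠ 0 := by
  have hsurj : Surjective (A.updateCol i c).mulVec := by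
    intro y
    obtain ⟨x, s, rfl⟩ := hspan y
    have hupd : ∀ z, (A.updateCol i c).mulVec z =
        A.mulVec (z - z i • (Pi.single i 1 : ι → K)) + z i • c := by
      intro z
      ext j
      have hz : ∀ l, A.updateCol i c j l * z l =
          A j l * (z - z i • (Pi.single i 1 : ι → K)) l + if l = i then z i * c j else 0 := by
        intro l
        by_cases hl : l = i
        · subst hl
          simp [mul_comm]
        · simp [hl]
      simp only [Matrix.mulVec, dotProduct, hz, Finset.sum_add_distrib, Pi.add_apply]
      simp
    refine ⟨x + s • (Pi.single i 1 : ι → K) - ((x i) / k i) • k, ?_⟩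
    have hzi : (x + s • (Pi.single i 1 : ι → K) - ((x i) / k i) • k) i = s := by
      simp [hi]
    rw [hupd, hzi]
    congr 1
    rw [show x + s • (Pi.single i 1 : ι → K) - (x i / k i) • k - s • Pi.single i 1 =
      x - (x i / k i) • k by abel, Matrix.mulVec_sub, Matrix.mulVec_smul, hk, smul_zero, sub_zero]
  have := Matrix.mulVec_surjective_iff_isUnit.1 hsurj
  exact ((Matrix.isUnit_iff_isUnit_det _).1 this).ne_zero

theorem ContDiffOn.matrix_det {𝕜 X ι : Type*} [NontriviallyNormedField 𝕜] [NormedAddCommGroup X]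
    [NormedSpace 𝕜 X] [Fintype ι] [DecidableEq ι] {n : WithTop ℕ∞} {U : Set X}
    {A : X → Matrix ι ι 𝕜} (hA : ∀ i j, ContDiffOn 𝕜 n (fun x => A x i j) U) :
    ContDiffOn 𝕜 n (fun x => (A x).det) U := by
  simp_rw [Matrix.det_apply]
  exact ContDiffOn.sum fun σ _ => (contDiffOn_prod fun i _ => hA _ _).const_smul _

/-- A `C^n` family of linear maps of corank one between spaces of equal dimension has a `C^n`
field of kernel vectors, nonzero where a given `C^n` field completes the range. -/
theorem exists_contDiffOn_kernel_field {X E F : Type*} [NormedAddCommGroup X] [NormedSpace ℝ X]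
    [NormedAddCommGroup E] [NormedSpace ℝ E] [FiniteDimensional ℝ E] [NormedAddCommGroup F]
    [NormedSpace ℝ F] [FiniteDimensional ℝ F] (hdim : finrank ℝ E = finrank ℝ F)
    {n : WithTop ℕ∞} {U : Set X} {L : X → E →L[ℝ] F} {c : X → F} (hL : ContDiffOn ℝ n L U)
    (hc : ContDiffOn ℝ n c U) (hns : ∀ p ∈ U, ¬ Surjective (L p)) :
    ∃ v : X → E, ContDiffOn ℝ n v U ∧ (∀ p ∈ U, L p (v p) = 0) ∧
      ∀ p ∈ U, (∀ y, ∃ x, ∃ s : ℝ, L p x + s • c p = y) → v p ≠ 0 := by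
  let bE := finBasis ℝ E
  let bF := finBasisOfFinrankEq ℝ F hdim.symm
  let A : X → Matrix (Fin (finrank ℝ E)) (Fin (finrank ℝ E)) ℝ := fun p =>
    LinearMap.toMatrix bE bF (L p)
  have hAv : ∀ p z, (A p).mulVec z = bF.equivFun (L p (bE.equivFun.symm z)) := by
    intro p z
    have := LinearMap.toMatrix_mulVec_repr bE bF (L p) (bE.equivFun.symm z)
    rw [← Basis.equivFun_apply, LinearEquiv.apply_symm_apply] at this
    exact this
  have hA : ∀ i j, ContDiffOn ℝ n (fun p => A p i j) U := fun i j => by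
    have := (LinearMap.toContinuousLinearMap (bF.coord i)).contDiff.comp_contDiffOn
      (hL.clm_apply (contDiffOn_const (c := bE j)))
    exact this.congr fun p _ => by simp [A, LinearMap.toMatrix_apply]
  have hcc : ∀ i, ContDiffOn ℝ n (fun p => bF.equivFun (c p) i) U := fun i =>
    (LinearMap.toContinuousLinearMap (bF.coord i)).contDiff.comp_contDiffOn hc
  have hdet : ∀ p ∈ U, (A p).det = 0 := fun p hp => by
    by_contra h
    have hu := Matrix.mulVec_surjective_iff_isUnit.2
      ((Matrix.isUnit_iff_isUnit_det _).2 (isUnit_iff_ne_zero.2 h))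
    refine hns p hp fun y => ?_
    obtain ⟨z, hz⟩ := hu (bF.equivFun y)
    rw [hAv] at hz
    exact ⟨_, bF.equivFun.injective hz⟩
  refine ⟨fun p => bE.equivFun.symm ((A p).cramer (bF.equivFun (c p))), ?_, ?_, ?_⟩
  · refine (LinearMap.toContinuousLinearMap
      (bE.equivFun.symm : (Fin (finrank ℝ E) → ℝ) →ₗ[ℝ] E)).contDiff.comp_contDiffOn
      (contDiffOn_pi.2 fun i => ?_)
    simp_rw [Matrix.cramer_apply]
    refine ContDiffOn.matrix_det fun j l => ?_
    by_cases h : l = i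
    · simpa [Matrix.updateCol_apply, h] using hcc j
    · simpa [Matrix.updateCol_apply, h] using hA j l
  · intro p hp
    have := hAv p ((A p).cramer (bF.equivFun (c p)))
    rw [Matrix.mulVec_cramer, hdet p hp, zero_smul] at this
    exact bF.equivFun.injective (by rw [← this, map_zero])
  · intro p hp hspan h0
    obtain ⟨k, hk0, hk⟩ := Matrix.exists_mulVec_eq_zero_iff.2 (hdet p hp)
    obtain ⟨i, hi⟩ := Function.ne_iff.1 hk0
    refine Matrix.det_updateCol_ne_zero_of_mulVec_eq_zero (c := bF.equivFun (c p)) hk hi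
      (fun y => ?_) ?_
    · obtain ⟨x, s, hxs⟩ := hspan (bF.equivFun.symm y)
      refine ⟨bE.equivFun x, s, ?_⟩
      rw [hAv, LinearEquiv.symm_apply_apply, ← map_smul, ← map_add, hxs,
        LinearEquiv.apply_symm_apply]
    · have h := (LinearEquiv.map_eq_zero_iff _).1 h0
      rw [← Matrix.cramer_apply, h, Pi.zero_apply]

end KernelField

section Sphere

variable {E : Type*} [NormedAddCommGroup E] [InnerProductSpace ℝ E]

/-- A map on a manifold with values in the sphere is `C^m` on a set as soon as it is so as a map to
the ambient space. -/
theorem contMDiffOn_sphere_of_coe {m : WithTop ℕ∞} {F H M : Type*} [NormedAddCommGroup F]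
    [NormedSpace ℝ F] [TopologicalSpace H] {I : ModelWithCorners ℝ F H} [TopologicalSpace M]
    [ChartedSpace H M] [IsManifold I m M] {n : ℕ} [Fact (finrank ℝ E = n + 1)]
    {f : M → sphere (0 : E) 1} {s : Set M}
    (hf : ContMDiffOn I 𝓘(ℝ, E) m (fun x => (f x : E)) s) : ContMDiffOn I (𝓡 n) m f s := by
  rw [contMDiffOn_iff_target]
  refine ⟨Topology.IsInducing.subtypeVal.continuousOn_iff.2 hf.continuousOn, fun v => ?_⟩
  let U : _ ≃ₗᵢ[ℝ] _ :=
    (OrthonormalBasis.fromOrthogonalSpanSingleton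
        n (ne_zero_of_mem_unit_sphere (-v))).repr
  have h : ContDiffOn ℝ ω _ Set.univ := U.contDiff.contDiffOn
  have H₁ := (h.comp_inter contDiffOn_stereoToFun).contMDiffOn
  convert! (H₁.of_le le_top).comp' hf using 1
  ext x
  have hfxv : (f x : E) = -↑v ↔ inner ℝ (f x : E) (-↑v) = 1 := by
    rw [inner_eq_one_iff_of_norm_eq_one (norm_eq_of_mem_sphere (f x))]
    exact norm_eq_of_mem_sphere (-v)
  simp [chartAt, ChartedSpace.chartAt, Subtype.ext_iff, hfxv, real_inner_comm]

open Classical in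
/-- The radial retraction onto the unit sphere, with junk value `e` at the origin. -/
noncomputable def sphereRetraction (e : sphere (0 : E) 1) (a : E) : sphere (0 : E) 1 :=
  if h : a = 0 then e else ⟨‖a‖⁻¹ • a, by simp [norm_smul, h]⟩

theorem coe_sphereRetraction (e : sphere (0 : E) 1) {a : E} (ha : a ≠ 0) :
    (sphereRetraction e a : E) = ‖a‖⁻¹ • a := by
  simp [sphereRetraction, ha]

theorem sphereRetraction_coe (e x : sphere (0 : E) 1) : sphereRetraction e (x : E) = x := by
  ext1
  rw [coe_sphereRetraction e (ne_zero_of_mem_unit_sphere x), norm_eq_of_mem_sphere, inv_one,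
    one_smul]

theorem sphereRetraction_smul (e : sphere (0 : E) 1) (a : E) {t : ℝ} (ht : 0 < t) :
    sphereRetraction e (t • a) = sphereRetraction e a := by
  by_cases ha : a = 0
  · simp [ha]
  · ext1
    rw [coe_sphereRetraction e ha, coe_sphereRetraction e (smul_ne_zero ht.ne' ha), norm_smul,
      Real.norm_of_nonneg ht.le, smul_smul, mul_inv, mul_right_comm, inv_mul_cancel₀ ht.ne',
      one_mul]

theorem contMDiffOn_sphereRetraction {m : WithTop ℕ∞} {n : ℕ} [Fact (finrank ℝ E = n + 1)]
    (e : sphere (0 : E) 1) :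
    ContMDiffOn 𝓘(ℝ, E) (𝓡 n) m (sphereRetraction e) {a | a ≠ 0} := by
  refine contMDiffOn_sphere_of_coe (ContDiffOn.contMDiffOn ?_)
  refine ContDiffOn.congr (f := fun a => ‖a‖⁻¹ • a) (fun a ha => ?_)
    fun a ha => coe_sphereRetraction e ha
  exact (((contDiffAt_norm ℝ ha).inv (norm_ne_zero_iff.2 ha)).smul contDiffAt_id).contDiffWithinAt

end Sphere

section Submersion

local notation "ℝ³" => EuclideanSpace ℝ (Fin 3)
local notation "ℝ⁴" => EuclideanSpace ℝ (Fin 4)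

/-- The extension of a map `S² × S² → S³` to a map homogeneous of degree zero in each variable. -/
noncomputable def homogeneousExtension
    (g : sphere (0 : ℝ³) 1 × sphere (0 : ℝ³) 1 → sphere (0 : ℝ⁴) 1) (p : ℝ³ × ℝ³) : ℝ⁴ :=
  let e : sphere (0 : ℝ³) 1 := ⟨EuclideanSpace.single 0 1, by simp⟩
  g (sphereRetraction e p.1, sphereRetraction e p.2)

variable {g : sphere (0 : ℝ³) 1 × sphere (0 : ℝ³) 1 → sphere (0 : ℝ⁴) 1}

theorem norm_homogeneousExtension (p : ℝ³ × ℝ³) : ‖homogeneousExtension g p‖ = 1 :=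
  norm_eq_of_mem_sphere _

theorem homogeneousExtension_coe (x y : sphere (0 : ℝ³) 1) :
    homogeneousExtension g ((x : ℝ³), (y : ℝ³)) = g (x, y) := by
  simp [homogeneousExtension, sphereRetraction_coe]

theorem homogeneousExtension_smul (p : ℝ³ × ℝ³) {s t : ℝ} (hs : 0 < s) (ht : 0 < t) :
    homogeneousExtension g (s • p.1, t • p.2) = homogeneousExtension g p := by
  simp [homogeneousExtension, sphereRetraction_smul _ _ hs, sphereRetraction_smul _ _ ht]

theorem isOpen_ne_zero_prod : IsOpen {p : ℝ³ × ℝ³ | p.1 ≠ 0 ∧ p.2 ≠ 0} :=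
  (isOpen_ne.preimage continuous_fst).inter (isOpen_ne.preimage continuous_snd)

theorem contDiffOn_homogeneousExtension
    (hg : ContMDiff ((𝓡 2).prod (𝓡 2)) (𝓡 3) (⊤ : ℕ∞) g) :
    ContDiffOn ℝ (⊤ : ℕ∞) (homogeneousExtension g) {p | p.1 ≠ 0 ∧ p.2 ≠ 0} := by
  have : Fact (finrank ℝ ℝ³ = 2 + 1) := ⟨finrank_euclideanSpace_fin⟩
  have : Fact (finrank ℝ ℝ⁴ = 3 + 1) := ⟨finrank_euclideanSpace_fin⟩
  intro p hp
  refine ContDiffAt.contDiffWithinAt (ContMDiffAt.contDiffAt ?_)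
  have h₁ : ContMDiffAt 𝓘(ℝ, ℝ³ × ℝ³) (𝓡 2) (⊤ : ℕ∞) (fun q : ℝ³ × ℝ³ =>
      sphereRetraction (⟨EuclideanSpace.single 0 1, by simp⟩ : sphere (0 : ℝ³) 1) q.1) p :=
    ((contMDiffOn_sphereRetraction _).contMDiffAt (isOpen_ne.mem_nhds hp.1)).comp p
      contDiff_fst.contMDiff.contMDiffAt
  have h₂ : ContMDiffAt 𝓘(ℝ, ℝ³ × ℝ³) (𝓡 2) (⊤ : ℕ∞) (fun q : ℝ³ × ℝ³ =>
      sphereRetraction (⟨EuclideanSpace.single 0 1, by simp⟩ : sphere (0 : ℝ³) 1) q.2) p :=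
    ((contMDiffOn_sphereRetraction _).contMDiffAt (isOpen_ne.mem_nhds hp.2)).comp p
      contDiff_snd.contMDiff.contMDiffAt
  exact (contMDiff_coe_sphere.comp hg).contMDiffAt.comp p (h₁.prodMk h₂)

theorem inner_homogeneousExtension_fderiv
    (hg : ContMDiff ((𝓡 2).prod (𝓡 2)) (𝓡 3) (⊤ : ℕ∞) g) {p : ℝ³ × ℝ³} (h₁ : p.1 ≠ 0)
    (h₂ : p.2 ≠ 0) (w : ℝ³ × ℝ³) :
    inner ℝ (homogeneousExtension g p) (fderiv ℝ (homogeneousExtension g) p w) = 0 := by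
  have hd : HasFDerivAt (homogeneousExtension g) (fderiv ℝ (homogeneousExtension g) p) p :=
    (((contDiffOn_homogeneousExtension hg).contDiffAt
      (isOpen_ne_zero_prod.mem_nhds ⟨h₁, h₂⟩)).differentiableAt (by simp)).hasFDerivAt
  have h := hd.norm_sq
  have hc : HasFDerivAt (fun q => ‖homogeneousExtension g q‖ ^ 2) (0 : ℝ³ × ℝ³ →L[ℝ] ℝ) p := by
    simp_rw [norm_homogeneousExtension]
    exact hasFDerivAt_const _ _
  have := DFunLike.congr_fun (h.unique hc) w
  simpa using this

theorem fderiv_homogeneousExtension_smul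
    (hg : ContMDiff ((𝓡 2).prod (𝓡 2)) (𝓡 3) (⊤ : ℕ∞) g) {p : ℝ³ × ℝ³} (h₁ : p.1 ≠ 0)
    (h₂ : p.2 ≠ 0) (α β : ℝ) :
    fderiv ℝ (homogeneousExtension g) p (α • p.1, β • p.2) = 0 := by
  have hd : HasFDerivAt (homogeneousExtension g) (fderiv ℝ (homogeneousExtension g) p) p :=
    (((contDiffOn_homogeneousExtension hg).contDiffAt
      (isOpen_ne_zero_prod.mem_nhds ⟨h₁, h₂⟩)).differentiableAt (by simp)).hasFDerivAt
  have hγ : ∀ (γ : ℝ) (a : ℝ³), HasDerivAt (fun t : ℝ => (1 + t * γ) • a) (γ • a) 0 := by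
    intro γ a
    simpa using (((hasDerivAt_id (0 : ℝ)).mul_const γ).const_add 1).smul_const a
  have hline : HasDerivAt (fun t : ℝ => ((1 + t * α) • p.1, (1 + t * β) • p.2))
      (α • p.1, β • p.2) 0 := (hγ α p.1).prodMk (hγ β p.2)
  have hcomp := hd.comp_hasDerivAt_of_eq 0 hline (by simp)
  have hpos : ∀ γ : ℝ, ∀ᶠ t : ℝ in 𝓝 0, 0 < 1 + t * γ := fun γ =>
    (show ContinuousAt (fun t : ℝ => 1 + t * γ) 0 by fun_prop).eventually_const_lt (by simp)
  refine hcomp.unique ((hasDerivAt_const (0 : ℝ)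
    (homogeneousExtension g p)).congr_of_eventuallyEq ?_)
  filter_upwards [hpos α, hpos β] with t hα hβ
  exact homogeneousExtension_smul p hα hβ

theorem exists_fderiv_homogeneousExtension_eq
    (hg : ContMDiff ((𝓡 2).prod (𝓡 2)) (𝓡 3) (⊤ : ℕ∞) g)
    (hsub : ∀ p, Surjective (mfderiv ((𝓡 2).prod (𝓡 2)) (𝓡 3) g p))
    {p : ℝ³ × ℝ³} (h₁ : ‖p.1‖ = 1) (h₂ : ‖p.2‖ = 1) {y : ℝ⁴}
    (hy : inner ℝ (homogeneousExtension g p) y = 0) :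
    ∃ w, fderiv ℝ (homogeneousExtension g) p w = y := by
  have : Fact (finrank ℝ ℝ³ = 2 + 1) := ⟨finrank_euclideanSpace_fin⟩
  have : Fact (finrank ℝ ℝ⁴ = 3 + 1) := ⟨finrank_euclideanSpace_fin⟩
  let x : sphere (0 : ℝ³) 1 × sphere (0 : ℝ³) 1 :=
    (⟨p.1, by simpa using h₁⟩, ⟨p.2, by simpa using h₂⟩)
  have hGx : homogeneousExtension g p = g x := homogeneousExtension_coe x.1 x.2
  let i : sphere (0 : ℝ³) 1 × sphere (0 : ℝ³) 1 → ℝ³ × ℝ³ := fun z => (z.1, z.2)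
  have hi : ContMDiff ((𝓡 2).prod (𝓡 2)) 𝓘(ℝ, ℝ³ × ℝ³) (⊤ : ℕ∞) i :=
    (contMDiff_coe_sphere.comp contMDiff_fst).prodMk_space
      (contMDiff_coe_sphere.comp contMDiff_snd)
  have hcomp : homogeneousExtension g ∘ i = (fun z : sphere (0 : ℝ⁴) 1 => (z : ℝ⁴)) ∘ g :=
    funext fun z => homogeneousExtension_coe z.1 z.2
  have hne : p.1 ≠ 0 ∧ p.2 ≠ 0 :=
    ⟨norm_ne_zero_iff.1 (by simp [h₁]), norm_ne_zero_iff.1 (by simp [h₂])⟩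
  have hG : HasFDerivAt (homogeneousExtension g) (fderiv ℝ (homogeneousExtension g) p) (i x) :=
    (((contDiffOn_homogeneousExtension hg).contDiffAt
      (isOpen_ne_zero_prod.mem_nhds hne)).differentiableAt (by simp)).hasFDerivAt
  have hmem : y ∈ (ℝ ∙ (g x : ℝ⁴))ᗮ := by
    rw [Submodule.mem_orthogonal_singleton_iff_inner_right, ← hGx, hy]
  rw [← range_mvfderiv_subtypeVal (n := 3) (g x)] at hmem
  obtain ⟨ξ, hξ⟩ := hmem
  obtain ⟨ζ, rfl⟩ := hsub x ξ
  refine ⟨mfderiv ((𝓡 2).prod (𝓡 2)) 𝓘(ℝ, ℝ³ × ℝ³) i x ζ, ?_⟩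
  have e₁ := hG.hasMFDerivAt.comp x (hi.mdifferentiable (by simp) x).hasMFDerivAt
  have e₂ := ((contMDiff_coe_sphere (n := 3) (m := 1) (E := ℝ⁴)).mdifferentiable (by simp)
    (g x)).hasMFDerivAt.comp x (hg.mdifferentiable (by simp) x).hasMFDerivAt
  rw [hcomp] at e₁
  exact (DFunLike.congr_fun (hasMFDerivAt_unique e₁ e₂) ζ).trans hξ

theorem not_exists_submersion_sphere_prod_sphere
    (hg : ContMDiff ((𝓡 2).prod (𝓡 2)) (𝓡 3) (⊤ : ℕ∞) g)
    (hsub : ∀ p, Surjective (mfderiv ((𝓡 2).prod (𝓡 2)) (𝓡 3) g p)) : False := by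
  set G := homogeneousExtension g with hG
  set U := {p : ℝ³ × ℝ³ | p.1 ≠ 0 ∧ p.2 ≠ 0} with hU
  let L : ℝ³ × ℝ³ → ℝ³ × ℝ³ →L[ℝ] (ℝ × ℝ) × ℝ⁴ := fun p =>
    (((innerSL ℝ p.1).comp (ContinuousLinearMap.fst ℝ ℝ³ ℝ³)).prod
      ((innerSL ℝ p.2).comp (ContinuousLinearMap.snd ℝ ℝ³ ℝ³))).prod (fderiv ℝ G p)
  let c : ℝ³ × ℝ³ → (ℝ × ℝ) × ℝ⁴ := fun p => (0, G p)
  have hGU : ContDiffOn ℝ (⊤ : ℕ∞) G U := contDiffOn_homogeneousExtension hg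
  have hdG : ContDiffOn ℝ 1 (fderiv ℝ G) U :=
    hGU.fderiv_of_isOpen isOpen_ne_zero_prod (by norm_cast)
  have hL : ContDiffOn ℝ 1 L U := contDiffOn_clm_apply.2 fun w => by
    refine ContDiffOn.prodMk ?_ (hdG.clm_apply contDiffOn_const)
    exact ((contDiff_fst.inner ℝ contDiff_const).prodMk
      (contDiff_snd.inner ℝ contDiff_const)).contDiffOn
  have hc : ContDiffOn ℝ 1 c U := contDiffOn_const.prodMk (hGU.of_le (by norm_cast))
  have hns : ∀ p ∈ U, ¬ Surjective (L p) := by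
    intro p hp hs
    obtain ⟨w, hw⟩ := hs (0, G p)
    have h := inner_homogeneousExtension_fderiv hg hp.1 hp.2 w
    rw [show fderiv ℝ (homogeneousExtension g) p w = G p from congrArg Prod.snd hw,
      real_inner_self_eq_norm_sq, norm_homogeneousExtension] at h
    norm_num at h
  obtain ⟨v, hv, hLv, hv0⟩ := exists_contDiffOn_kernel_field (by simp) hL hc hns
  obtain ⟨p, h₁, h₂, hp⟩ := exists_zero_of_tangent_field hv fun p hp₁ hp₂ =>
    have h := hLv p ⟨hp₁, hp₂⟩
    ⟨congrArg (fun q => q.1.1) h, congrArg (fun q => q.1.2) h⟩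
  have hne : p.1 ≠ 0 ∧ p.2 ≠ 0 :=
    ⟨norm_ne_zero_iff.1 (by simp [h₁]), norm_ne_zero_iff.1 (by simp [h₂])⟩
  refine hv0 p hne (fun ⟨⟨α, β⟩, y⟩ => ?_) hp
  have hy : inner ℝ (G p) (y - inner ℝ (G p) y • G p) = 0 := by
    rw [inner_sub_right, inner_smul_right, real_inner_self_eq_norm_sq,
      norm_homogeneousExtension]
    ring
  obtain ⟨w, hw⟩ := exists_fderiv_homogeneousExtension_eq hg hsub h₁ h₂ hy
  refine ⟨w + ((α - inner ℝ p.1 w.1) • p.1, (β - inner ℝ p.2 w.2) • p.2),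
    inner ℝ (G p) y, ?_⟩
  have h0 := fderiv_homogeneousExtension_smul hg hne.1 hne.2 (α - inner ℝ p.1 w.1)
    (β - inner ℝ p.2 w.2)
  refine Prod.ext (Prod.ext ?_ ?_) ?_
  · simp [L, c, inner_add_right, inner_smul_right, h₁]
  · simp [L, c, inner_add_right, inner_smul_right, h₂]
  · change fderiv ℝ (homogeneousExtension g) p _ + _ • G p = y
    rw [map_add, h0, hw]
    simp

end Submersion

end

open Metric
open scoped Manifold

noncomputable section

/-- There is no smooth submersion `P² × P² → P³` between real projective spaces.

Since the quotient maps `S² × S² → P² × P²` and `S³ → P³` are smooth double coverings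
(local diffeomorphisms), a smooth map `P² × P² → P³` is the same thing as a smooth map
`g̃ : S² × S² → S³` which descends to the quotients, i.e. satisfies
`g̃(-x,-y) = g̃(x,y)` for all `x, y`, or `g̃(-x,-y) = -g̃(x,y)` for all `x, y`
(the sign is constant by connectedness); and the map of quotients is a submersion iff
`g̃` is.  So the statement is: there is no smooth submersion `g̃ : S² × S² → S³`
descending to the quotients. -/
theorem stmt1 :
    ¬ ∃ g : (sphere (0 : EuclideanSpace ℝ (Fin 3)) 1 × sphere (0 : EuclideanSpace ℝ (Fin 3)) 1) →
        sphere (0 : EuclideanSpace ℝ (Fin 4)) 1,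
      ContMDiff ((𝓡 2).prod (𝓡 2)) (𝓡 3) (⊤ : ℕ∞) g ∧
      ((∀ x y, g (-x, -y) = g (x, y)) ∨ (∀ x y, g (-x, -y) = -g (x, y))) ∧
      (∀ p, Function.Surjective (mfderiv ((𝓡 2).prod (𝓡 2)) (𝓡 3) g p)) := by
  rintro ⟨g, hg, -, hsub⟩
  exact not_exists_submersion_sphere_prod_sphere hg hsub

end
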